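/- The class of unsatisfiable hitting CNF formulas is closed under factorisation: if G is an unsatisfiable hitting formula, F ⊆ G is a pseudo-factor of G, and C is a clause interpolant of (F, G \ F), then both F[¬C] and (G \ F) ∪ {C} are unsatisfiable hitting formulas. -/

import Mathlib

/-- A literal: a variable (natural number) with a polarity. -/
abbrev Lit : Type := ℕ × Bool

/-- Negation of a literal. -/
def Lit.neg (ℓ : Lit) : Lit := (ℓ.1, !ℓ.2)

/-- A clause: a finite set of literals. -/
abbrev Clause : Type := Finset Lit

/-- A clause is non-tautological: it contains no literal together with its negation. -/
def Clause.NonTaut (C : Clause) : Prop := ∀ ℓ ∈ C, Lit.neg ℓ ∉ C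

/-- A CNF formula: a finite set of clauses. -/
abbrev CNF : Type := Finset Clause

/-- A CNF formula is well-formed if all of its clauses are non-tautological. -/
def CNF.WellFormed (F : CNF) : Prop := ∀ C ∈ F, C.NonTaut

/-- A (total) assignment `τ` satisfies a literal. -/
def SatLit (τ : ℕ → Bool) (ℓ : Lit) : Prop := τ ℓ.1 = ℓ.2

/-- An assignment satisfies a clause if it satisfies some literal of it. -/
def SatClause (τ : ℕ → Bool) (C : Clause) : Prop := ∃ ℓ ∈ C, SatLit τ ℓ

/-- An assignment satisfies a CNF formula if it satisfies all of its clauses. -/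
def SatCNF (τ : ℕ → Bool) (F : CNF) : Prop := ∀ C ∈ F, SatClause τ C

/-- A CNF formula is unsatisfiable if no assignment satisfies it. -/
def Unsat (F : CNF) : Prop := ¬ ∃ τ : ℕ → Bool, SatCNF τ F

/-- `F` entails `G`: every model of `F` is a model of `G`. -/
def Entails (F G : CNF) : Prop := ∀ τ : ℕ → Bool, SatCNF τ F → SatCNF τ G

/-- Logical equivalence of CNF formulas. -/
def Equivalent (F G : CNF) : Prop := Entails F G ∧ Entails G F

/-- Two clauses clash: one contains a literal whose negation is in the other. -/
def Clash (C D : Clause) : Prop := ∃ ℓ ∈ C, Lit.neg ℓ ∈ D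

/-- A formula is hitting if every pair of distinct clauses clashes. -/
def Hitting (F : CNF) : Prop := ∀ C ∈ F, ∀ D ∈ F, C ≠ D → Clash C D

/-- The set of variables occurring in a CNF formula. -/
def cnfVars (F : CNF) : Finset ℕ := F.sup fun C => C.image Prod.fst

/-- `D` is the resolvent of `C₁` and `C₂` (on the unique clashing literal `ℓ`). -/
def Resolvent (C₁ C₂ D : Clause) : Prop :=
  ∃ ℓ : Lit, C₁ ∩ C₂.image Lit.neg = {ℓ} ∧ D = (C₁ ∪ C₂) \ {ℓ, Lit.neg ℓ}

/-- `L` is a resolution refutation of `F`: every clause of the sequence is an axiom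
(clause of `F`) or a resolvent of two earlier clauses, and the last clause is empty. -/
def IsRefutation (F : CNF) (L : List Clause) : Prop :=
  L ≠ [] ∧ L.getLast? = some (∅ : Clause) ∧
    ∀ i < L.length, L.getD i ∅ ∈ F ∨
      ∃ j k, j < i ∧ k < i ∧ Resolvent (L.getD j ∅) (L.getD k ∅) (L.getD i ∅)

/-- Resolution hardness: the minimum length of a resolution refutation. -/
noncomputable def hardness (F : CNF) : ℕ :=
  sInf {n | ∃ L : List Clause, IsRefutation F L ∧ L.length = n}

/-- The restriction `F[¬C]`: the result of setting all literals of `C` to 0 in `F`. -/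
def restrictByNegC (F : CNF) (C : Clause) : CNF :=
  (F.filter fun D => ∀ ℓ ∈ C, Lit.neg ℓ ∉ D).image fun D => D \ C

/-- `C` is a clause interpolant of `(F, H)`: `F ⊨ C` and `{C} ∪ H` is unsatisfiable. -/
def ClauseInterpolant (C : Clause) (F H : CNF) : Prop :=
  C.NonTaut ∧ Entails F {C} ∧ Unsat (insert C H)

/-- `F` is a factor of `G`: a subset of `G` logically equivalent to a single clause. -/
def IsFactor (F G : CNF) : Prop :=
  F ⊆ G ∧ ∃ C : Clause, C.NonTaut ∧ Equivalent F {C}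

/-- `F` is a pseudo-factor of `G`: `(F, G \ F)` has a clause interpolant. -/
def IsPseudoFactor (F G : CNF) : Prop :=
  F ⊆ G ∧ ∃ C : Clause, ClauseInterpolant C F (G \ F)

/-- `G` is irreducible: every factor has size 1 or `|G|`. -/
def CNF.Irreducible (G : CNF) : Prop :=
  ∀ F : CNF, IsFactor F G → F.card = 1 ∨ F.card = G.card

/-- `G` is strongly irreducible: every pseudo-factor has size 1 or `|G|`. -/
def StronglyIrreducible (G : CNF) : Prop :=
  ∀ F : CNF, IsPseudoFactor F G → F.card = 1 ∨ F.card = G.card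

/-- `F` is minimally unsatisfiable: unsatisfiable, but every proper subset is satisfiable. -/
def MinimallyUnsat (F : CNF) : Prop :=
  Unsat F ∧ ∀ G : CNF, G ⊂ F → ∃ τ : ℕ → Bool, SatCNF τ G

theorem Lit.neg_neg (ℓ : Lit) : Lit.neg (Lit.neg ℓ) = ℓ := by
  simp [Lit.neg]

theorem satLit_neg_iff (τ : ℕ → Bool) (ℓ : Lit) : SatLit τ (Lit.neg ℓ) ↔ ¬ SatLit τ ℓ := by
  obtain ⟨v, b⟩ := ℓ
  cases b <;> simp [SatLit, Lit.neg]

theorem Clash.symm {C D : Clause} (h : Clash C D) : Clash D C := by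
  obtain ⟨ℓ, hC, hD⟩ := h
  exact ⟨Lit.neg ℓ, hD, by rwa [Lit.neg_neg]⟩

/-- Two clashing clauses are never falsified by the same assignment. -/
theorem Clash.satClause_or {C D : Clause} (h : Clash C D) (τ : ℕ → Bool) :
    SatClause τ C ∨ SatClause τ D := by
  obtain ⟨ℓ, hC, hD⟩ := h
  by_cases hτ : SatLit τ ℓ
  · exact Or.inl ⟨ℓ, hC, hτ⟩
  · exact Or.inr ⟨Lit.neg ℓ, hD, (satLit_neg_iff τ ℓ).2 hτ⟩

/-- Any assignment can be modified on the variables of a non-tautological clause so as to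
falsify it. -/
theorem Clause.NonTaut.exists_falsifying {C : Clause} (hC : C.NonTaut) (τ : ℕ → Bool) :
    ∃ σ : ℕ → Bool, (∀ ℓ ∈ C, ¬ SatLit σ ℓ) ∧
      ∀ ℓ : Lit, ℓ ∉ C → Lit.neg ℓ ∉ C → SatLit τ ℓ → SatLit σ ℓ := by
  refine ⟨fun v => if (v, true) ∈ C then false else if (v, false) ∈ C then true else τ v,
    ?_, ?_⟩
  · rintro ⟨v, b⟩ h
    have h' := hC _ h
    cases b <;> simp_all [SatLit, Lit.neg]
  · rintro ⟨v, b⟩ h h' hτ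
    cases b <;> simp_all [SatLit, Lit.neg]

theorem Clause.NonTaut.union {C D : Clause} (hC : C.NonTaut) (hD : D.NonTaut)
    (h : ¬ Clash C D) : Clause.NonTaut (C ∪ D) := by
  intro ℓ hℓ hn
  rcases Finset.mem_union.1 hℓ with h1 | h1 <;> rcases Finset.mem_union.1 hn with h2 | h2
  · exact hC ℓ h1 h2
  · exact h ⟨ℓ, h1, h2⟩
  · exact h (Clash.symm ⟨ℓ, h1, h2⟩)
  · exact hD ℓ h1 h2

theorem mem_restrictByNegC {F : CNF} {C D : Clause} :
    D ∈ restrictByNegC F C ↔ ∃ E ∈ F, (∀ ℓ ∈ C, Lit.neg ℓ ∉ E) ∧ E \ C = D := by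
  simp [restrictByNegC, and_assoc]

theorem Hitting.restrictByNegC {F : CNF} (hF : Hitting F) (C : Clause) :
    Hitting (restrictByNegC F C) := by
  intro D hD D' hD' hne
  obtain ⟨E, hE, hEC, rfl⟩ := mem_restrictByNegC.1 hD
  obtain ⟨E', hE', hEC', rfl⟩ := mem_restrictByNegC.1 hD'
  obtain ⟨ℓ, hℓ, hℓ'⟩ := hF E hE E' hE' (fun h => hne (by rw [h]))
  refine ⟨ℓ, Finset.mem_sdiff.2 ⟨hℓ, fun h => hEC' ℓ h hℓ'⟩,
    Finset.mem_sdiff.2 ⟨hℓ', fun h => hEC _ h ?_⟩⟩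
  rwa [Lit.neg_neg]

theorem Entails.unsat_restrictByNegC {F : CNF} {C : Clause} (hFC : Entails F {C})
    (hC : C.NonTaut) : Unsat (restrictByNegC F C) := by
  rintro ⟨τ, hτ⟩
  obtain ⟨σ, hσC, hσ⟩ := hC.exists_falsifying τ
  have hσF : SatCNF σ F := by
    intro D hD
    by_cases h : ∃ ℓ ∈ C, Lit.neg ℓ ∈ D
    · obtain ⟨ℓ, hℓ, hℓD⟩ := h
      exact ⟨_, hℓD, (satLit_neg_iff σ ℓ).2 (hσC ℓ hℓ)⟩
    · push Not at h
      obtain ⟨ℓ, hℓ, hsat⟩ := hτ (D \ C) (mem_restrictByNegC.2 ⟨D, hD, h, rfl⟩)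
      obtain ⟨hℓD, hℓC⟩ := Finset.mem_sdiff.1 hℓ
      exact ⟨ℓ, hℓD, hσ ℓ hℓC (fun hn => h _ hn (by rwa [Lit.neg_neg])) hsat⟩
  obtain ⟨ℓ, hℓ, hsat⟩ := hFC σ hσF C (Finset.mem_singleton_self C)
  exact hσC ℓ hℓ hsat

/-- A clause entailed by part of a hitting formula clashes with all remaining clauses. -/
theorem Hitting.clash_of_entails {G F : CNF} {C D : Clause} (hG : Hitting G) (hFG : F ⊆ G)
    (hFC : Entails F {C}) (hC : C.NonTaut) (hD : D.NonTaut) (hDG : D ∈ G \ F) :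
    Clash C D := by
  by_contra h
  obtain ⟨hDG, hDF⟩ := Finset.mem_sdiff.1 hDG
  obtain ⟨σ, hσ, -⟩ := (hC.union hD h).exists_falsifying fun _ => true
  have hσD : ¬ SatClause σ D := fun ⟨ℓ, hℓ, hs⟩ => hσ ℓ (Finset.mem_union_right _ hℓ) hs
  have hσF : SatCNF σ F := fun E hE =>
    ((hG E (hFG hE) D hDG (fun he => hDF (he ▸ hE))).satClause_or σ).resolve_right hσD
  obtain ⟨ℓ, hℓ, hs⟩ := hFC σ hσF C (Finset.mem_singleton_self C)
  exact hσ ℓ (Finset.mem_union_left _ hℓ) hs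

/-- the class of unsatisfiable hitting formulas is closed under
factorisation: if `G` is an unsatisfiable hitting formula, `F ⊆ G`, and `C` is a
clause interpolant of `(F, G \ F)`, then both `F[¬C]` and `(G \ F) ∪ {C}` are
unsatisfiable hitting formulas. -/
theorem hitting_closed_under_factorisation (G F : CNF) (C : Clause)
    (hwf : G.WellFormed) (hhit : Hitting G) (hunsat : Unsat G) (hFG : F ⊆ G)
    (hint : ClauseInterpolant C F (G \ F)) :
    (Hitting (restrictByNegC F C) ∧ Unsat (restrictByNegC F C)) ∧
      (Hitting (insert C (G \ F)) ∧ Unsat (insert C (G \ F))) := by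
  obtain ⟨hC, hFC, hCunsat⟩ := hint
  have hF : Hitting F := fun D hD E hE => hhit D (hFG hD) E (hFG hE)
  have hclash : ∀ D ∈ G \ F, Clash C D := fun D hD =>
    hhit.clash_of_entails hFG hFC hC (hwf D (Finset.mem_sdiff.1 hD).1) hD
  refine ⟨⟨hF.restrictByNegC C, hFC.unsat_restrictByNegC hC⟩, ?_, hCunsat⟩
  intro D hD E hE hne
  rcases Finset.mem_insert.1 hD with rfl | hDG <;>
    rcases Finset.mem_insert.1 hE with rfl | hEG
  · exact absurd rfl hne
  · exact hclash E hEG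
  · exact (hclash D hDG).symm
  · exact hhit D (Finset.mem_sdiff.1 hDG).1 E (Finset.mem_sdiff.1 hEG).1 hne
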